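/- arXiv:1201.1575 — 3 statements merged into one kernel-verified Lean document; each statement's English description precedes it below -/
import Mathlib

section
/- Let 𝒱 be a model category which is also a monoidal category with pushouts such that, for every object X, the functors X ⊗ - and - ⊗ X preserve pushouts. Given a pushout square in 𝒱 with top f : U → V, left h : U → X, bottom f' : X → Y and right h' : V → Y, if f is a pseudo-cofibration then so is f'. -/
universe w v u

open CategoryTheory Category Limits MonoidalCategory

namespace Stmt2

/-- A (Quillen closed) model category structure on a category `C`: three classes of
morphisms, the weak equivalences, cofibrations and fibrations, such that `C` has finite
limits and colimits, the weak equivalences satisfy two-out-of-three, all three classes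
are closed under retracts, (trivial) cofibrations have the left lifting property with
respect to trivial fibrations (resp. fibrations), and every morphism factors both as a
cofibration followed by a trivial fibration and as a trivial cofibration followed by a
fibration. -/
class ModelCategory (C : Type u) [Category.{v} C] where
  weq : MorphismProperty C
  cof : MorphismProperty C
  fib : MorphismProperty C
  hasFiniteLimits : HasFiniteLimits C
  hasFiniteColimits : HasFiniteColimits C
  weq_twoOutOfThree : weq.HasTwoOutOfThreeProperty
  weq_retract : ∀ ⦃X Y X' Y' : C⦄ (f : X ⟶ Y) (f' : X' ⟶ Y')
    (i₁ : X ⟶ X') (i₂ : Y ⟶ Y') (r₁ : X' ⟶ X) (r₂ : Y' ⟶ Y),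
    i₁ ≫ r₁ = 𝟙 X → i₂ ≫ r₂ = 𝟙 Y → i₁ ≫ f' = f ≫ i₂ → r₁ ≫ f = f' ≫ r₂ →
    weq f' → weq f
  cof_retract : ∀ ⦃X Y X' Y' : C⦄ (f : X ⟶ Y) (f' : X' ⟶ Y')
    (i₁ : X ⟶ X') (i₂ : Y ⟶ Y') (r₁ : X' ⟶ X) (r₂ : Y' ⟶ Y),
    i₁ ≫ r₁ = 𝟙 X → i₂ ≫ r₂ = 𝟙 Y → i₁ ≫ f' = f ≫ i₂ → r₁ ≫ f = f' ≫ r₂ →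
    cof f' → cof f
  fib_retract : ∀ ⦃X Y X' Y' : C⦄ (f : X ⟶ Y) (f' : X' ⟶ Y')
    (i₁ : X ⟶ X') (i₂ : Y ⟶ Y') (r₁ : X' ⟶ X) (r₂ : Y' ⟶ Y),
    i₁ ≫ r₁ = 𝟙 X → i₂ ≫ r₂ = 𝟙 Y → i₁ ≫ f' = f ≫ i₂ → r₁ ≫ f = f' ≫ r₂ →
    fib f' → fib f
  lift_cof_trivFib : ∀ ⦃A B X Y : C⦄ (i : A ⟶ B) (p : X ⟶ Y),
    cof i → weq p → fib p → HasLiftingProperty i p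
  lift_trivCof_fib : ∀ ⦃A B X Y : C⦄ (i : A ⟶ B) (p : X ⟶ Y),
    cof i → weq i → fib p → HasLiftingProperty i p
  factor_cof_trivFib : ∀ ⦃X Y : C⦄ (f : X ⟶ Y),
    ∃ (Z : C) (i : X ⟶ Z) (p : Z ⟶ Y), cof i ∧ weq p ∧ fib p ∧ i ≫ p = f
  factor_trivCof_fib : ∀ ⦃X Y : C⦄ (f : X ⟶ Y),
    ∃ (Z : C) (i : X ⟶ Z) (p : Z ⟶ Y), cof i ∧ weq i ∧ fib p ∧ i ≫ p = f

variable {C : Type u} [Category.{v} C] [MonoidalCategory C] [HasPushouts C]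

/-- The pushout product `f □ g : (U ⊗ Y) ⊔_{U ⊗ X} (V ⊗ X) ⟶ V ⊗ Y` of
`f : U ⟶ V` and `g : X ⟶ Y`, induced by `f ⊗ 𝟙 Y` and `𝟙 V ⊗ g`. -/
noncomputable def pushoutProduct {U V X Y : C} (f : U ⟶ V) (g : X ⟶ Y) :
    pushout (U ◁ g) (f ▷ X) ⟶ V ⊗ Y :=
  pushout.desc (f ▷ Y) (V ◁ g) (whisker_exchange f g)

variable [ModelCategory C]

/-- A morphism `f` is a pseudo-cofibration if `f □ g` is a cofibration for every
cofibration `g`, and `f □ g` is a trivial cofibration for every trivial cofibration `g`. -/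
def IsPseudoCofibration {U V : C} (f : U ⟶ V) : Prop :=
  (∀ ⦃X Y : C⦄ (g : X ⟶ Y), ModelCategory.cof g →
    ModelCategory.cof (pushoutProduct f g)) ∧
  (∀ ⦃X Y : C⦄ (g : X ⟶ Y), ModelCategory.cof g → ModelCategory.weq g →
    ModelCategory.cof (pushoutProduct f g) ∧ ModelCategory.weq (pushoutProduct f g))

section

variable {D : Type u} [Category.{v} D]

section

variable [MonoidalCategory D] [HasPushouts D]

theorem inl_pushoutProduct {U V X Y : D} (f : U ⟶ V) (g : X ⟶ Y) :
    pushout.inl (U ◁ g) (f ▷ X) ≫ pushoutProduct f g = f ▷ Y :=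
  pushout.inl_desc _ _ _

theorem inr_pushoutProduct {U V X Y : D} (f : U ⟶ V) (g : X ⟶ Y) :
    pushout.inr (U ◁ g) (f ▷ X) ≫ pushoutProduct f g = V ◁ g :=
  pushout.inr_desc _ _ _

theorem isPushout_pushoutProduct {U V X Y A B : D} {f : U ⟶ V} {h : U ⟶ X} {h' : V ⟶ Y}
    {f' : X ⟶ Y} (g : A ⟶ B) (hA : IsPushout (f ▷ A) (h ▷ A) (h' ▷ A) (f' ▷ A))
    (hB : IsPushout (f ▷ B) (h ▷ B) (h' ▷ B) (f' ▷ B)) :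
    IsPushout (pushoutProduct f g)
      (pushout.map (U ◁ g) (f ▷ A) (X ◁ g) (f' ▷ A) (h ▷ B) (h' ▷ A) (h ▷ A)
        (whisker_exchange h g) hA.w)
      (h' ▷ B) (pushoutProduct f' g) := by
  have hQ := (IsPushout.of_hasPushout (U ◁ g) (f ▷ A)).flip
  have hQ' := (IsPushout.of_hasPushout (X ◁ g) (f' ▷ A)).flip
  have hleft : IsPushout (pushout.inl (U ◁ g) (f ▷ A)) (h ▷ B)
      (pushout.map (U ◁ g) (f ▷ A) (X ◁ g) (f' ▷ A) (h ▷ B) (h' ▷ A) (h ▷ A)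
        (whisker_exchange h g) hA.w) (pushout.inl (X ◁ g) (f' ▷ A)) := by
    refine IsPushout.of_top (h₁₁ := f ▷ A) (v₁₁ := U ◁ g)
      (v₁₂ := pushout.inr (U ◁ g) (f ▷ A)) ?_ (pushout.inl_desc _ _ _) hQ
    rw [whisker_exchange, pushout.inr_desc]
    exact hA.paste_vert hQ'
  refine IsPushout.of_left ?_ ?_ hleft
  · simpa only [inl_pushoutProduct] using hB
  · apply pushout.hom_ext
    · rw [← Category.assoc, inl_pushoutProduct, pushout.inl_desc_assoc, Category.assoc,
        inl_pushoutProduct, hB.w]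
    · rw [← Category.assoc, inr_pushoutProduct, pushout.inr_desc_assoc, Category.assoc,
        inr_pushoutProduct, whisker_exchange]

end

namespace ModelCategory

variable [ModelCategory D]

theorem cof_of_hasLiftingProperty {A B : D} (i : A ⟶ B)
    (hi : ∀ ⦃E F : D⦄ (p : E ⟶ F), weq p → fib p → HasLiftingProperty i p) : cof i := by
  obtain ⟨Z, j, p, hj, hpw, hpf, fac⟩ := factor_cof_trivFib i
  have := hi p hpw hpf
  have sq : CommSq j i p (𝟙 B) := ⟨by simpa using fac⟩
  exact cof_retract i j (𝟙 A) sq.lift (𝟙 A) p (by simp) sq.fac_right (by simp)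
    (by simpa using fac.symm) hj

theorem cof_and_weq_of_hasLiftingProperty {A B : D} (i : A ⟶ B)
    (hi : ∀ ⦃E F : D⦄ (p : E ⟶ F), fib p → HasLiftingProperty i p) : cof i ∧ weq i := by
  obtain ⟨Z, j, p, hjc, hjw, hpf, fac⟩ := factor_trivCof_fib i
  have := hi p hpf
  have sq : CommSq j i p (𝟙 B) := ⟨by simpa using fac⟩
  exact ⟨cof_retract i j (𝟙 A) sq.lift (𝟙 A) p (by simp) sq.fac_right (by simp)
      (by simpa using fac.symm) hjc,
    weq_retract i j (𝟙 A) sq.lift (𝟙 A) p (by simp) sq.fac_right (by simp)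
      (by simpa using fac.symm) hjw⟩

theorem cof_of_isPushout {A B A' B' : D} {i : A ⟶ B} {a : A ⟶ A'} {b : B ⟶ B'}
    {i' : A' ⟶ B'} (sq : IsPushout i a b i') (hi : cof i) : cof i' :=
  cof_of_hasLiftingProperty i' fun _ _ p hpw hpf ↦
    have := lift_cof_trivFib i p hi hpw hpf
    sq.flip.hasLiftingProperty p

theorem cof_and_weq_of_isPushout {A B A' B' : D} {i : A ⟶ B} {a : A ⟶ A'} {b : B ⟶ B'}
    {i' : A' ⟶ B'} (sq : IsPushout i a b i') (hi : cof i ∧ weq i) : cof i' ∧ weq i' :=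
  cof_and_weq_of_hasLiftingProperty i' fun _ _ p hpf ↦
    have := lift_trivCof_fib i p hi.1 hi.2 hpf
    sq.flip.hasLiftingProperty p

end ModelCategory

end

/-!
Statement 2: in a model category `𝒱` with a monoidal structure with pushouts such that
tensoring on either side preserves pushouts, the cobase change (pushout) of a
pseudo-cofibration is a pseudo-cofibration.
-/
theorem isPseudoCofibration_of_isPushout
    (hL : ∀ X : C, Nonempty (PreservesColimitsOfShape WalkingSpan (tensorLeft X)))
    (hR : ∀ X : C, Nonempty (PreservesColimitsOfShape WalkingSpan (tensorRight X)))
    {U V X Y : C} (f : U ⟶ V) (h : U ⟶ X) (h' : V ⟶ Y) (f' : X ⟶ Y)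
    (sq : IsPushout f h h' f')
    (hf : IsPseudoCofibration f) :
    IsPseudoCofibration f' := by
  have hA (A : C) : IsPushout (f ▷ A) (h ▷ A) (h' ▷ A) (f' ▷ A) :=
    have := (hR A).some
    sq.map (tensorRight A)
  have hsq {A B : C} (g : A ⟶ B) := isPushout_pushoutProduct g (hA A) (hA B)
  exact ⟨fun _ _ g hg ↦ ModelCategory.cof_of_isPushout (hsq g) (hf.1 g hg),
    fun _ _ g hgc hgw ↦ ModelCategory.cof_and_weq_of_isPushout (hsq g) (hf.2 g hgc hgw)⟩

end Stmt2
end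

section
/- Let 𝒱 be a model category which is also a monoidal category with pushouts such that, for every object X, the functors X ⊗ - and - ⊗ X preserve pushouts. If f : U → V and f' : V → W are pseudo-cofibrations in 𝒱, then the composite f' ∘ f : U → W is a pseudo-cofibration. -/
universe w v u

open CategoryTheory Category Limits MonoidalCategory

namespace Stmt4

/-- A (Quillen closed) model category structure on a category `C`: three classes of
morphisms, the weak equivalences, cofibrations and fibrations, such that `C` has finite
limits and colimits, the weak equivalences satisfy two-out-of-three, all three classes
are closed under retracts, (trivial) cofibrations have the left lifting property with
respect to trivial fibrations (resp. fibrations), and every morphism factors both as a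
cofibration followed by a trivial fibration and as a trivial cofibration followed by a
fibration. -/
class ModelCategory (C : Type u) [Category.{v} C] where
  weq : MorphismProperty C
  cof : MorphismProperty C
  fib : MorphismProperty C
  hasFiniteLimits : HasFiniteLimits C
  hasFiniteColimits : HasFiniteColimits C
  weq_twoOutOfThree : weq.HasTwoOutOfThreeProperty
  weq_retract : ∀ ⦃X Y X' Y' : C⦄ (f : X ⟶ Y) (f' : X' ⟶ Y')
    (i₁ : X ⟶ X') (i₂ : Y ⟶ Y') (r₁ : X' ⟶ X) (r₂ : Y' ⟶ Y),
    i₁ ≫ r₁ = 𝟙 X → i₂ ≫ r₂ = 𝟙 Y → i₁ ≫ f' = f ≫ i₂ → r₁ ≫ f = f' ≫ r₂ →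
    weq f' → weq f
  cof_retract : ∀ ⦃X Y X' Y' : C⦄ (f : X ⟶ Y) (f' : X' ⟶ Y')
    (i₁ : X ⟶ X') (i₂ : Y ⟶ Y') (r₁ : X' ⟶ X) (r₂ : Y' ⟶ Y),
    i₁ ≫ r₁ = 𝟙 X → i₂ ≫ r₂ = 𝟙 Y → i₁ ≫ f' = f ≫ i₂ → r₁ ≫ f = f' ≫ r₂ →
    cof f' → cof f
  fib_retract : ∀ ⦃X Y X' Y' : C⦄ (f : X ⟶ Y) (f' : X' ⟶ Y')
    (i₁ : X ⟶ X') (i₂ : Y ⟶ Y') (r₁ : X' ⟶ X) (r₂ : Y' ⟶ Y),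
    i₁ ≫ r₁ = 𝟙 X → i₂ ≫ r₂ = 𝟙 Y → i₁ ≫ f' = f ≫ i₂ → r₁ ≫ f = f' ≫ r₂ →
    fib f' → fib f
  lift_cof_trivFib : ∀ ⦃A B X Y : C⦄ (i : A ⟶ B) (p : X ⟶ Y),
    cof i → weq p → fib p → HasLiftingProperty i p
  lift_trivCof_fib : ∀ ⦃A B X Y : C⦄ (i : A ⟶ B) (p : X ⟶ Y),
    cof i → weq i → fib p → HasLiftingProperty i p
  factor_cof_trivFib : ∀ ⦃X Y : C⦄ (f : X ⟶ Y),
    ∃ (Z : C) (i : X ⟶ Z) (p : Z ⟶ Y), cof i ∧ weq p ∧ fib p ∧ i ≫ p = f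
  factor_trivCof_fib : ∀ ⦃X Y : C⦄ (f : X ⟶ Y),
    ∃ (Z : C) (i : X ⟶ Z) (p : Z ⟶ Y), cof i ∧ weq i ∧ fib p ∧ i ≫ p = f

variable {C : Type u} [Category.{v} C] [MonoidalCategory C] [HasPushouts C]

/-- The pushout product `f □ g : (U ⊗ Y) ⊔_{U ⊗ X} (V ⊗ X) ⟶ V ⊗ Y` of
`f : U ⟶ V` and `g : X ⟶ Y`, induced by `f ⊗ 𝟙 Y` and `𝟙 V ⊗ g`. -/
noncomputable def pushoutProduct {U V X Y : C} (f : U ⟶ V) (g : X ⟶ Y) :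
    pushout (U ◁ g) (f ▷ X) ⟶ V ⊗ Y :=
  pushout.desc (f ▷ Y) (V ◁ g) (whisker_exchange f g)

variable [ModelCategory C]

/-- A morphism `f` is a pseudo-cofibration if `f □ g` is a cofibration for every
cofibration `g`, and `f □ g` is a trivial cofibration for every trivial cofibration `g`. -/
def IsPseudoCofibration {U V : C} (f : U ⟶ V) : Prop :=
  (∀ ⦃X Y : C⦄ (g : X ⟶ Y), ModelCategory.cof g →
    ModelCategory.cof (pushoutProduct f g)) ∧
  (∀ ⦃X Y : C⦄ (g : X ⟶ Y), ModelCategory.cof g → ModelCategory.weq g →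
    ModelCategory.cof (pushoutProduct f g) ∧ ModelCategory.weq (pushoutProduct f g))



lemma inl_pushoutProduct_assoc {D : Type u} [Category.{v} D] [MonoidalCategory D] [HasPushouts D]
    {U V X Y Z : D} (f : U ⟶ V) (g : X ⟶ Y) (h : V ⊗ Y ⟶ Z) :
    pushout.inl _ _ ≫ pushoutProduct f g ≫ h = f ▷ Y ≫ h :=
  pushout.inl_desc_assoc _ _ _ _

lemma inr_pushoutProduct_assoc {D : Type u} [Category.{v} D] [MonoidalCategory D] [HasPushouts D]
    {U V X Y Z : D} (f : U ⟶ V) (g : X ⟶ Y) (h : V ⊗ Y ⟶ Z) :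
    pushout.inr _ _ ≫ pushoutProduct f g ≫ h = V ◁ g ≫ h :=
  pushout.inr_desc_assoc _ _ _ _

/-- The left lifting property of `f □ g`, spelled out on the two legs of the pushout. -/
lemma exists_lift_of_hasLiftingProperty_pushoutProduct {D : Type u} [Category.{v} D]
    [MonoidalCategory D] [HasPushouts D] {U V X Y A B : D} {f : U ⟶ V} {g : X ⟶ Y} {p : A ⟶ B}
    (h : HasLiftingProperty (pushoutProduct f g) p)
    (a : U ⊗ Y ⟶ A) (b : V ⊗ X ⟶ A) (c : V ⊗ Y ⟶ B) (hab : U ◁ g ≫ a = f ▷ X ≫ b)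
    (hac : a ≫ p = f ▷ Y ≫ c) (hbc : b ≫ p = V ◁ g ≫ c) :
    ∃ l : V ⊗ Y ⟶ A, f ▷ Y ≫ l = a ∧ V ◁ g ≫ l = b ∧ l ≫ p = c := by
  have sq : CommSq (pushout.desc a b hab) (pushoutProduct f g) p c :=
    ⟨by apply pushout.hom_ext <;>
      simp [inl_pushoutProduct_assoc, inr_pushoutProduct_assoc, pushout.inl_desc_assoc,
        pushout.inr_desc_assoc, hac, hbc]⟩
  refine ⟨sq.lift, ?_, ?_, sq.fac_right⟩
  · rw [← inl_pushoutProduct_assoc, sq.fac_left, pushout.inl_desc]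
  · rw [← inr_pushoutProduct_assoc, sq.fac_left, pushout.inr_desc]

lemma hasLiftingProperty_pushoutProduct_comp {D : Type u} [Category.{v} D]
    [MonoidalCategory D] [HasPushouts D] {U V W X Y A B : D} {f : U ⟶ V} {f' : V ⟶ W}
    {g : X ⟶ Y} {p : A ⟶ B} (h : HasLiftingProperty (pushoutProduct f g) p)
    (h' : HasLiftingProperty (pushoutProduct f' g) p) :
    HasLiftingProperty (pushoutProduct (f ≫ f') g) p where
  sq_hasLift {t c} sq := by
    have hl : pushout.inl _ _ ≫ t ≫ p = f ▷ Y ≫ f' ▷ Y ≫ c := by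
      rw [sq.w, inl_pushoutProduct_assoc, comp_whiskerRight, assoc]
    have hr : pushout.inr _ _ ≫ t ≫ p = W ◁ g ≫ c := by
      rw [sq.w, inr_pushoutProduct_assoc]
    obtain ⟨l, hl₁, hl₂, hl₃⟩ := exists_lift_of_hasLiftingProperty_pushoutProduct h
      (pushout.inl _ _ ≫ t) (f' ▷ X ≫ pushout.inr _ _ ≫ t) (f' ▷ Y ≫ c)
      (by simpa using pushout.condition_assoc (f := U ◁ g) (g := (f ≫ f') ▷ X) t)
      (by simpa using hl) (by simp [hr, whisker_exchange_assoc])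
    obtain ⟨m, hm₁, hm₂, hm₃⟩ := exists_lift_of_hasLiftingProperty_pushoutProduct h'
      l (pushout.inr _ _ ≫ t) c hl₂ hl₃ (by simpa using hr)
    exact ⟨⟨⟨m, by
      apply pushout.hom_ext <;>
      simp [inl_pushoutProduct_assoc, inr_pushoutProduct_assoc, hm₁, hm₂, hl₁], hm₃⟩⟩⟩

lemma ModelCategory.cof_of_hasLiftingProperty {D : Type u} [Category.{v} D] [ModelCategory D]
    {X Y : D} (f : X ⟶ Y)
    (h : ∀ ⦃A B : D⦄ (p : A ⟶ B), weq p → fib p → HasLiftingProperty f p) : cof f := by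
  obtain ⟨Z, i, p, hi, hpw, hpf, fac⟩ := factor_cof_trivFib f
  have := h p hpw hpf
  have sq : CommSq i f p (𝟙 Y) := ⟨by simp [fac]⟩
  exact cof_retract f i (𝟙 X) sq.lift (𝟙 X) p (by simp) sq.fac_right (by simp) (by simp [fac]) hi

lemma ModelCategory.weq_of_hasLiftingProperty {D : Type u} [Category.{v} D] [ModelCategory D]
    {X Y : D} (f : X ⟶ Y)
    (h : ∀ ⦃A B : D⦄ (p : A ⟶ B), fib p → HasLiftingProperty f p) : weq f := by
  obtain ⟨Z, i, p, -, hi, hpf, fac⟩ := factor_trivCof_fib f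
  have := h p hpf
  have sq : CommSq i f p (𝟙 Y) := ⟨by simp [fac]⟩
  exact weq_retract f i (𝟙 X) sq.lift (𝟙 X) p (by simp) sq.fac_right (by simp) (by simp [fac]) hi

/-!
Statement 4: in a model category `𝒱` with a monoidal structure with pushouts such that
tensoring on either side preserves pushouts, the composite of two pseudo-cofibrations
is a pseudo-cofibration.
-/
theorem isPseudoCofibration_comp
    (hL : ∀ X : C, Nonempty (PreservesColimitsOfShape WalkingSpan (tensorLeft X)))
    (hR : ∀ X : C, Nonempty (PreservesColimitsOfShape WalkingSpan (tensorRight X)))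
    {U V W : C} (f : U ⟶ V) (f' : V ⟶ W)
    (hf : IsPseudoCofibration f) (hf' : IsPseudoCofibration f') :
    IsPseudoCofibration (f ≫ f') := by
  have cof_comp : ∀ ⦃X Y : C⦄ (g : X ⟶ Y), ModelCategory.cof g →
      ModelCategory.cof (pushoutProduct (f ≫ f') g) := fun X Y g hg =>
    ModelCategory.cof_of_hasLiftingProperty _ fun _ _ p hpw hpf =>
      hasLiftingProperty_pushoutProduct_comp
        (ModelCategory.lift_cof_trivFib _ p (hf.1 g hg) hpw hpf)
        (ModelCategory.lift_cof_trivFib _ p (hf'.1 g hg) hpw hpf)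
  refine ⟨cof_comp, fun X Y g hg hgw => ⟨cof_comp g hg, ?_⟩⟩
  have h := hf.2 g hg hgw
  have h' := hf'.2 g hg hgw
  exact ModelCategory.weq_of_hasLiftingProperty _ fun _ _ p hpf =>
    hasLiftingProperty_pushoutProduct_comp
      (ModelCategory.lift_trivCof_fib _ p h.1 h.2 hpf)
      (ModelCategory.lift_trivCof_fib _ p h'.1 h'.2 hpf)

end Stmt4
end

section
/- Let 𝒞 be a monoidal category with pushouts in which, for every object X, the functors X ⊗ - and - ⊗ X preserve pushouts. Let f : U → V and f' : V → W be composable morphisms and g : X → Y any morphism in 𝒞. Let h : (U ⊗ Y) ⊔_{U ⊗ X} (W ⊗ X) → (V ⊗ Y) ⊔_{V ⊗ X} (W ⊗ X) be the morphism induced on pushouts by f ⊗ id_Y on the first component, f ⊗ id_X in the middle, and id_{W ⊗ X} on the second component. Then: (i) the square whose top is the pushout product f □ g : (U ⊗ Y) ⊔_{U ⊗ X} (V ⊗ X) → V ⊗ Y, whose left vertical is the morphism (U ⊗ Y) ⊔_{U ⊗ X} (V ⊗ X) → (U ⊗ Y) ⊔_{U ⊗ X} (W ⊗ X) induced by id_{U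 ⊗ Y} and f' ⊗ id_X, whose bottom is h, and whose right vertical is the canonical morphism V ⊗ Y → (V ⊗ Y) ⊔_{V ⊗ X} (W ⊗ X), is a pushout square (so h is a cobase change of f □ g); and (ii) the pushout product (f' ∘ f) □ g : (U ⊗ Y) ⊔_{U ⊗ X} (W ⊗ X) → W ⊗ Y equals the composite (f' □ g) ∘ h, where f' □ g : (V ⊗ Y) ⊔_{V ⊗ X} (W ⊗ X) → W ⊗ Y. -/
/-!
Statement 5 (decomposition of the pushout product of a composite, cf. (6.7) in Muro):
for composable `f : U ⟶ V`, `f' : V ⟶ W` and any `g : X ⟶ Y` in a monoidal category with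
pushouts in which tensoring on either side preserves pushouts, the pushout product
`(f' ∘ f) □ g` factors as `(f' □ g) ∘ h`, where
`h : (U ⊗ Y) ⊔_{U ⊗ X} (W ⊗ X) ⟶ (V ⊗ Y) ⊔_{V ⊗ X} (W ⊗ X)` is a cobase change of `f □ g`.
-/

universe v u

open CategoryTheory Category Limits MonoidalCategory

namespace Stmt5

variable {C : Type u} [Category.{v} C] [MonoidalCategory C] [HasPushouts C]

/-- The pushout product `f □ g : (U ⊗ Y) ⊔_{U ⊗ X} (V ⊗ X) ⟶ V ⊗ Y` of
`f : U ⟶ V` and `g : X ⟶ Y`, induced by `f ⊗ 𝟙 Y` and `𝟙 V ⊗ g`. -/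
noncomputable def pushoutProduct {U V X Y : C} (f : U ⟶ V) (g : X ⟶ Y) :
    pushout (U ◁ g) (f ▷ X) ⟶ V ⊗ Y :=
  pushout.desc (f ▷ Y) (V ◁ g) (whisker_exchange f g)

/-- The morphism `h : (U ⊗ Y) ⊔_{U ⊗ X} (W ⊗ X) ⟶ (V ⊗ Y) ⊔_{V ⊗ X} (W ⊗ X)` induced on
pushouts by `f ⊗ 𝟙 Y` on the first component, `f ⊗ 𝟙 X` in the middle, and the identity
of `W ⊗ X` on the second component. -/
noncomputable def midMap {U V W X Y : C} (f : U ⟶ V) (f' : V ⟶ W) (g : X ⟶ Y) :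
    pushout (U ◁ g) ((f ≫ f') ▷ X) ⟶ pushout (V ◁ g) (f' ▷ X) :=
  pushout.map (U ◁ g) ((f ≫ f') ▷ X) (V ◁ g) (f' ▷ X)
    (f ▷ Y) (𝟙 (W ⊗ X)) (f ▷ X) (whisker_exchange f g) (by simp)

/-- The morphism `(U ⊗ Y) ⊔_{U ⊗ X} (V ⊗ X) ⟶ (U ⊗ Y) ⊔_{U ⊗ X} (W ⊗ X)` induced by the
identity of `U ⊗ Y` and `f' ⊗ 𝟙 X : V ⊗ X ⟶ W ⊗ X`. -/
noncomputable def leftMap {U V W X Y : C} (f : U ⟶ V) (f' : V ⟶ W) (g : X ⟶ Y) :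
    pushout (U ◁ g) (f ▷ X) ⟶ pushout (U ◁ g) ((f ≫ f') ▷ X) :=
  pushout.map (U ◁ g) (f ▷ X) (U ◁ g) ((f ≫ f') ▷ X)
    (𝟙 (U ⊗ Y)) (f' ▷ X) (𝟙 (U ⊗ X)) (by simp) (by simp)

lemma inl_pushoutProduct {U V X Y : C} (f : U ⟶ V) (g : X ⟶ Y) :
    pushout.inl (U ◁ g) (f ▷ X) ≫ pushoutProduct f g = f ▷ Y :=
  pushout.inl_desc _ _ _

lemma inr_pushoutProduct {U V X Y : C} (f : U ⟶ V) (g : X ⟶ Y) :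
    pushout.inr (U ◁ g) (f ▷ X) ≫ pushoutProduct f g = V ◁ g :=
  pushout.inr_desc _ _ _

lemma inl_leftMap {U V W X Y : C} (f : U ⟶ V) (f' : V ⟶ W) (g : X ⟶ Y) :
    pushout.inl (U ◁ g) (f ▷ X) ≫ leftMap f f' g = pushout.inl (U ◁ g) ((f ≫ f') ▷ X) :=
  (pushout.inl_desc _ _ _).trans (id_comp _)

lemma inr_leftMap {U V W X Y : C} (f : U ⟶ V) (f' : V ⟶ W) (g : X ⟶ Y) :
    pushout.inr (U ◁ g) (f ▷ X) ≫ leftMap f f' g =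
      f' ▷ X ≫ pushout.inr (U ◁ g) ((f ≫ f') ▷ X) :=
  pushout.inr_desc _ _ _

lemma inl_midMap {U V W X Y : C} (f : U ⟶ V) (f' : V ⟶ W) (g : X ⟶ Y) :
    pushout.inl (U ◁ g) ((f ≫ f') ▷ X) ≫ midMap f f' g =
      f ▷ Y ≫ pushout.inl (V ◁ g) (f' ▷ X) :=
  pushout.inl_desc _ _ _

lemma inr_midMap {U V W X Y : C} (f : U ⟶ V) (f' : V ⟶ W) (g : X ⟶ Y) :
    pushout.inr (U ◁ g) ((f ≫ f') ▷ X) ≫ midMap f f' g = pushout.inr (V ◁ g) (f' ▷ X) :=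
  (pushout.inr_desc _ _ _).trans (id_comp _)

/-- `leftMap f f' g` is a cobase change of `f' ▷ X`. -/
lemma isPushout_leftMap {U V W X Y : C} (f : U ⟶ V) (f' : V ⟶ W) (g : X ⟶ Y) :
    IsPushout (pushout.inr (U ◁ g) (f ▷ X)) (f' ▷ X) (leftMap f f' g)
      (pushout.inr (U ◁ g) ((f ≫ f') ▷ X)) := by
  refine (IsPushout.of_left (h₁₁ := f ▷ X) (v₁₁ := U ◁ g) (h₂₁ := pushout.inl _ _) ?_
    (inr_leftMap f f' g).symm (IsPushout.of_hasPushout (U ◁ g) (f ▷ X)).flip).flip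
  rw [inl_leftMap, ← comp_whiskerRight]
  exact (IsPushout.of_hasPushout _ _).flip

theorem pushoutProduct_comp
    (hL : ∀ X : C, Nonempty (PreservesColimitsOfShape WalkingSpan (tensorLeft X)))
    (hR : ∀ X : C, Nonempty (PreservesColimitsOfShape WalkingSpan (tensorRight X)))
    {U V W X Y : C} (f : U ⟶ V) (f' : V ⟶ W) (g : X ⟶ Y) :
    IsPushout (pushoutProduct f g) (leftMap f f' g)
        (pushout.inl (V ◁ g) (f' ▷ X)) (midMap f f' g) ∧
      pushoutProduct (f ≫ f') g = midMap f f' g ≫ pushoutProduct f' g := by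
  refine ⟨IsPushout.of_left (h₁₁ := pushout.inr _ _) (v₁₁ := f' ▷ X) (h₂₁ := pushout.inr _ _)
    ?_ ?_ (isPushout_leftMap f f' g), ?_⟩
  · rw [inr_pushoutProduct, inr_midMap]
    exact IsPushout.of_hasPushout _ _
  · apply pushout.hom_ext
    · rw [← assoc, ← assoc, inl_pushoutProduct, inl_leftMap, inl_midMap]
    · rw [← assoc, ← assoc, inr_pushoutProduct, inr_leftMap, assoc, inr_midMap, pushout.condition]
  · apply pushout.hom_ext
    · rw [← assoc, inl_pushoutProduct, inl_midMap, assoc, inl_pushoutProduct, comp_whiskerRight]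
    · rw [← assoc, inr_pushoutProduct, inr_midMap, inr_pushoutProduct]

end Stmt5
end
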